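/- Every sequent derivable in !L1 has a cut-free derivation in !L1, and every sequent derivable in !wL1 has a cut-free derivation in !wL1. -/

import Mathlib

namespace Lambek

/-! ## Formulae of `!bL1` (Lambek calculus with unit, brackets and subexponential) -/

/-- Formulae: primitive types, the unit `1`, `\`, `/`, `·`, `⟨⟩`, `[]⁻¹`, `!`. -/
inductive Fm : Type
  | var : ℕ → Fm
  | one : Fm
  | ldiv : Fm → Fm → Fm   -- `ldiv A C` is `A \ C`
  | rdiv : Fm → Fm → Fm   -- `rdiv C B` is `C / B`
  | mul : Fm → Fm → Fm    -- `A · B`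
  | dia : Fm → Fm         -- `⟨⟩ A`
  | binv : Fm → Fm        -- `[]⁻¹ A`
  | bang : Fm → Fm        -- `! A`

/-- Items of a meta-formula: a formula or a bracketed meta-formula. -/
inductive Item : Type
  | fm : Fm → Item
  | br : List Item → Item

/-- Meta-formulae (configurations): finite ordered sequences of items. -/
abbrev Meta := List Item

/-- `!A₁, …, !Aₙ` as a meta-formula. -/
def bangs (Φ : List Fm) : Meta := Φ.map (fun F => Item.fm (Fm.bang F))

/-- A meta-formula with a designated (hole) occurrence of a meta-formula,
possibly under nested brackets. -/
inductive Ctx : Type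
  | hole : Meta → Meta → Ctx
  | br : Meta → Ctx → Meta → Ctx

/-- Plug a meta-formula into the designated occurrence. -/
def Ctx.fill : Ctx → Meta → Meta
  | Ctx.hole Δ₁ Δ₂, Γ => Δ₁ ++ Γ ++ Δ₂
  | Ctx.br Δ₁ c Δ₂, Γ => Δ₁ ++ (Item.br (c.fill Γ)) :: Δ₂

/-- Derivability in `!bL1`.  The boolean parameter says whether the rule (cut)
is allowed: `DervB true` is full `!bL1`, `DervB false` is cut-free derivability. -/
inductive DervB : Bool → Meta → Fm → Prop
  | id (cf : Bool) (A : Fm) : DervB cf [Item.fm A] A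
  | one_r (cf : Bool) : DervB cf [] Fm.one
  | rdiv_l (cf : Bool) (Δ : Ctx) (Γ : Meta) (B C D : Fm) :
      DervB cf Γ B → DervB cf (Δ.fill [Item.fm C]) D →
      DervB cf (Δ.fill (Item.fm (Fm.rdiv C B) :: Γ)) D
  | rdiv_r (cf : Bool) (Γ : Meta) (B C : Fm) :
      DervB cf (Γ ++ [Item.fm B]) C → DervB cf Γ (Fm.rdiv C B)
  | ldiv_l (cf : Bool) (Δ : Ctx) (Γ : Meta) (A C D : Fm) :
      DervB cf Γ A → DervB cf (Δ.fill [Item.fm C]) D →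
      DervB cf (Δ.fill (Γ ++ [Item.fm (Fm.ldiv A C)])) D
  | ldiv_r (cf : Bool) (Γ : Meta) (A C : Fm) :
      DervB cf (Item.fm A :: Γ) C → DervB cf Γ (Fm.ldiv A C)
  | mul_l (cf : Bool) (Δ : Ctx) (A B D : Fm) :
      DervB cf (Δ.fill [Item.fm A, Item.fm B]) D →
      DervB cf (Δ.fill [Item.fm (Fm.mul A B)]) D
  | mul_r (cf : Bool) (Γ₁ Γ₂ : Meta) (A B : Fm) :
      DervB cf Γ₁ A → DervB cf Γ₂ B → DervB cf (Γ₁ ++ Γ₂) (Fm.mul A B)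
  | one_l (cf : Bool) (Δ : Ctx) (A : Fm) :
      DervB cf (Δ.fill []) A → DervB cf (Δ.fill [Item.fm Fm.one]) A
  | dia_l (cf : Bool) (Δ : Ctx) (A C : Fm) :
      DervB cf (Δ.fill [Item.br [Item.fm A]]) C →
      DervB cf (Δ.fill [Item.fm (Fm.dia A)]) C
  | dia_r (cf : Bool) (Θ : Meta) (A : Fm) :
      DervB cf Θ A → DervB cf [Item.br Θ] (Fm.dia A)
  | binv_l (cf : Bool) (Δ : Ctx) (A C : Fm) :
      DervB cf (Δ.fill [Item.fm A]) C →
      DervB cf (Δ.fill [Item.br [Item.fm (Fm.binv A)]]) C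
  | binv_r (cf : Bool) (Θ : Meta) (A : Fm) :
      DervB cf [Item.br Θ] A → DervB cf Θ (Fm.binv A)
  | bang_l (cf : Bool) (Δ : Ctx) (A B : Fm) :
      DervB cf (Δ.fill [Item.fm A]) B → DervB cf (Δ.fill [Item.fm (Fm.bang A)]) B
  | bang_r (cf : Bool) (Φ : List Fm) (A : Fm) :
      DervB cf (bangs Φ) A → DervB cf (bangs Φ) (Fm.bang A)
  | contr (cf : Bool) (Δ : Ctx) (Φ : List Fm) (Γ : Meta) (B : Fm) :
      Φ ≠ [] →
      DervB cf (Δ.fill (bangs Φ ++ [Item.br (bangs Φ ++ Γ)])) B →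
      DervB cf (Δ.fill (bangs Φ ++ Γ)) B
  | perm1 (cf : Bool) (Δ : Ctx) (A : Fm) (Γ : Meta) (B : Fm) :
      DervB cf (Δ.fill (Item.fm (Fm.bang A) :: Γ)) B →
      DervB cf (Δ.fill (Γ ++ [Item.fm (Fm.bang A)])) B
  | perm2 (cf : Bool) (Δ : Ctx) (A : Fm) (Γ : Meta) (B : Fm) :
      DervB cf (Δ.fill (Γ ++ [Item.fm (Fm.bang A)])) B →
      DervB cf (Δ.fill (Item.fm (Fm.bang A) :: Γ)) B
  | cut (Δ : Ctx) (Θ : Meta) (A C : Fm) :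
      DervB true Θ A → DervB true (Δ.fill [Item.fm A]) C →
      DervB true (Δ.fill Θ) C

/-! ## Bracket-free formulae and the calculi `!L1` and `!wL1` -/

/-- Bracket-free formulae (language of `!L1` / `!wL1`). -/
inductive Fm0 : Type
  | var : ℕ → Fm0
  | one : Fm0
  | ldiv : Fm0 → Fm0 → Fm0
  | rdiv : Fm0 → Fm0 → Fm0
  | mul : Fm0 → Fm0 → Fm0
  | bang : Fm0 → Fm0

/-- Derivability in `!L1` / `!wL1`.  The first boolean allows the weakening
rule (`DervL true` is `!wL1`, `DervL false` is `!L1`); the second boolean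
allows the rule (cut). -/
inductive DervL : Bool → Bool → List Fm0 → Fm0 → Prop
  | id (w cf : Bool) (A : Fm0) : DervL w cf [A] A
  | one_r (w cf : Bool) : DervL w cf [] Fm0.one
  | rdiv_l (w cf : Bool) (Γ Δ₁ Δ₂ : List Fm0) (B C D : Fm0) :
      DervL w cf Γ B → DervL w cf (Δ₁ ++ C :: Δ₂) D →
      DervL w cf (Δ₁ ++ Fm0.rdiv C B :: (Γ ++ Δ₂)) D
  | rdiv_r (w cf : Bool) (Γ : List Fm0) (B C : Fm0) :
      DervL w cf (Γ ++ [B]) C → DervL w cf Γ (Fm0.rdiv C B)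
  | ldiv_l (w cf : Bool) (Γ Δ₁ Δ₂ : List Fm0) (A C D : Fm0) :
      DervL w cf Γ A → DervL w cf (Δ₁ ++ C :: Δ₂) D →
      DervL w cf (Δ₁ ++ Γ ++ Fm0.ldiv A C :: Δ₂) D
  | ldiv_r (w cf : Bool) (Γ : List Fm0) (A C : Fm0) :
      DervL w cf (A :: Γ) C → DervL w cf Γ (Fm0.ldiv A C)
  | mul_l (w cf : Bool) (Δ₁ Δ₂ : List Fm0) (A B D : Fm0) :
      DervL w cf (Δ₁ ++ A :: B :: Δ₂) D → DervL w cf (Δ₁ ++ Fm0.mul A B :: Δ₂) D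
  | mul_r (w cf : Bool) (Γ₁ Γ₂ : List Fm0) (A B : Fm0) :
      DervL w cf Γ₁ A → DervL w cf Γ₂ B → DervL w cf (Γ₁ ++ Γ₂) (Fm0.mul A B)
  | one_l (w cf : Bool) (Δ₁ Δ₂ : List Fm0) (A : Fm0) :
      DervL w cf (Δ₁ ++ Δ₂) A → DervL w cf (Δ₁ ++ Fm0.one :: Δ₂) A
  | bang_l (w cf : Bool) (Δ₁ Δ₂ : List Fm0) (A B : Fm0) :
      DervL w cf (Δ₁ ++ A :: Δ₂) B → DervL w cf (Δ₁ ++ Fm0.bang A :: Δ₂) B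
  | bang_r (w cf : Bool) (Φ : List Fm0) (A : Fm0) :
      DervL w cf (Φ.map Fm0.bang) A → DervL w cf (Φ.map Fm0.bang) (Fm0.bang A)
  | perm1 (w cf : Bool) (Δ₁ Γ Δ₂ : List Fm0) (A B : Fm0) :
      DervL w cf (Δ₁ ++ Fm0.bang A :: (Γ ++ Δ₂)) B →
      DervL w cf (Δ₁ ++ Γ ++ Fm0.bang A :: Δ₂) B
  | perm2 (w cf : Bool) (Δ₁ Γ Δ₂ : List Fm0) (A B : Fm0) :
      DervL w cf (Δ₁ ++ Γ ++ Fm0.bang A :: Δ₂) B →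
      DervL w cf (Δ₁ ++ Fm0.bang A :: (Γ ++ Δ₂)) B
  | contr (w cf : Bool) (Δ₁ Δ₂ : List Fm0) (A B : Fm0) :
      DervL w cf (Δ₁ ++ Fm0.bang A :: Fm0.bang A :: Δ₂) B →
      DervL w cf (Δ₁ ++ Fm0.bang A :: Δ₂) B
  | weak (cf : Bool) (Δ₁ Δ₂ : List Fm0) (A B : Fm0) :
      DervL true cf (Δ₁ ++ Δ₂) B → DervL true cf (Δ₁ ++ Fm0.bang A :: Δ₂) B
  | cut (w : Bool) (Θ Δ₁ Δ₂ : List Fm0) (A C : Fm0) :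
      DervL w true Θ A → DervL w true (Δ₁ ++ A :: Δ₂) C →
      DervL w true (Δ₁ ++ Θ ++ Δ₂) C

/-! ## The Lambek calculus with unit `L1` and theories `L1 + T` -/

/-- Formulae of `L1` (no `!`, no bracket modalities). -/
inductive Fm1 : Type
  | var : ℕ → Fm1
  | one : Fm1
  | ldiv : Fm1 → Fm1 → Fm1
  | rdiv : Fm1 → Fm1 → Fm1
  | mul : Fm1 → Fm1 → Fm1

/-- Sequents of `L1`. -/
abbrev Seq1 := List Fm1 × Fm1

/-- Derivability in `L1 + T` (sequents of `T` are extra axioms). -/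
inductive DervT (T : Set Seq1) : List Fm1 → Fm1 → Prop
  | id (A : Fm1) : DervT T [A] A
  | one_r : DervT T [] Fm1.one
  | ax (Γ : List Fm1) (A : Fm1) : (Γ, A) ∈ T → DervT T Γ A
  | rdiv_l (Γ Δ₁ Δ₂ : List Fm1) (B C D : Fm1) :
      DervT T Γ B → DervT T (Δ₁ ++ C :: Δ₂) D →
      DervT T (Δ₁ ++ Fm1.rdiv C B :: (Γ ++ Δ₂)) D
  | rdiv_r (Γ : List Fm1) (B C : Fm1) :
      DervT T (Γ ++ [B]) C → DervT T Γ (Fm1.rdiv C B)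
  | ldiv_l (Γ Δ₁ Δ₂ : List Fm1) (A C D : Fm1) :
      DervT T Γ A → DervT T (Δ₁ ++ C :: Δ₂) D →
      DervT T (Δ₁ ++ Γ ++ Fm1.ldiv A C :: Δ₂) D
  | ldiv_r (Γ : List Fm1) (A C : Fm1) :
      DervT T (A :: Γ) C → DervT T Γ (Fm1.ldiv A C)
  | mul_l (Δ₁ Δ₂ : List Fm1) (A B D : Fm1) :
      DervT T (Δ₁ ++ A :: B :: Δ₂) D → DervT T (Δ₁ ++ Fm1.mul A B :: Δ₂) D
  | mul_r (Γ₁ Γ₂ : List Fm1) (A B : Fm1) :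
      DervT T Γ₁ A → DervT T Γ₂ B → DervT T (Γ₁ ++ Γ₂) (Fm1.mul A B)
  | one_l (Δ₁ Δ₂ : List Fm1) (A : Fm1) :
      DervT T (Δ₁ ++ Δ₂) A → DervT T (Δ₁ ++ Fm1.one :: Δ₂) A
  | cut (Θ Δ₁ Δ₂ : List Fm1) (A C : Fm1) :
      DervT T Θ A → DervT T (Δ₁ ++ A :: Δ₂) C →
      DervT T (Δ₁ ++ Θ ++ Δ₂) C

/-- Derivability in `L1 + T` where every application of (cut) must have a
sequent from `T` as one of its premises. -/
inductive DervTr (T : Set Seq1) : List Fm1 → Fm1 → Prop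
  | id (A : Fm1) : DervTr T [A] A
  | one_r : DervTr T [] Fm1.one
  | ax (Γ : List Fm1) (A : Fm1) : (Γ, A) ∈ T → DervTr T Γ A
  | rdiv_l (Γ Δ₁ Δ₂ : List Fm1) (B C D : Fm1) :
      DervTr T Γ B → DervTr T (Δ₁ ++ C :: Δ₂) D →
      DervTr T (Δ₁ ++ Fm1.rdiv C B :: (Γ ++ Δ₂)) D
  | rdiv_r (Γ : List Fm1) (B C : Fm1) :
      DervTr T (Γ ++ [B]) C → DervTr T Γ (Fm1.rdiv C B)
  | ldiv_l (Γ Δ₁ Δ₂ : List Fm1) (A C D : Fm1) :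
      DervTr T Γ A → DervTr T (Δ₁ ++ C :: Δ₂) D →
      DervTr T (Δ₁ ++ Γ ++ Fm1.ldiv A C :: Δ₂) D
  | ldiv_r (Γ : List Fm1) (A C : Fm1) :
      DervTr T (A :: Γ) C → DervTr T Γ (Fm1.ldiv A C)
  | mul_l (Δ₁ Δ₂ : List Fm1) (A B D : Fm1) :
      DervTr T (Δ₁ ++ A :: B :: Δ₂) D → DervTr T (Δ₁ ++ Fm1.mul A B :: Δ₂) D
  | mul_r (Γ₁ Γ₂ : List Fm1) (A B : Fm1) :
      DervTr T Γ₁ A → DervTr T Γ₂ B → DervTr T (Γ₁ ++ Γ₂) (Fm1.mul A B)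
  | one_l (Δ₁ Δ₂ : List Fm1) (A : Fm1) :
      DervTr T (Δ₁ ++ Δ₂) A → DervTr T (Δ₁ ++ Fm1.one :: Δ₂) A
  | cut (Θ Δ₁ Δ₂ : List Fm1) (A C : Fm1) :
      (Θ, A) ∈ T ∨ (Δ₁ ++ A :: Δ₂, C) ∈ T →
      DervTr T Θ A → DervTr T (Δ₁ ++ A :: Δ₂) C →
      DervTr T (Δ₁ ++ Θ ++ Δ₂) C

/-- Derivability in `L1 + T` by a derivation all of whose sequents satisfy
the predicate `Good`. -/
inductive DervTgood (T : Set Seq1) (Good : List Fm1 → Fm1 → Prop) : List Fm1 → Fm1 → Prop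
  | id (A : Fm1) : Good [A] A → DervTgood T Good [A] A
  | one_r : Good [] Fm1.one → DervTgood T Good [] Fm1.one
  | ax (Γ : List Fm1) (A : Fm1) : (Γ, A) ∈ T → Good Γ A → DervTgood T Good Γ A
  | rdiv_l (Γ Δ₁ Δ₂ : List Fm1) (B C D : Fm1) :
      DervTgood T Good Γ B → DervTgood T Good (Δ₁ ++ C :: Δ₂) D →
      Good (Δ₁ ++ Fm1.rdiv C B :: (Γ ++ Δ₂)) D →
      DervTgood T Good (Δ₁ ++ Fm1.rdiv C B :: (Γ ++ Δ₂)) D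
  | rdiv_r (Γ : List Fm1) (B C : Fm1) :
      DervTgood T Good (Γ ++ [B]) C → Good Γ (Fm1.rdiv C B) →
      DervTgood T Good Γ (Fm1.rdiv C B)
  | ldiv_l (Γ Δ₁ Δ₂ : List Fm1) (A C D : Fm1) :
      DervTgood T Good Γ A → DervTgood T Good (Δ₁ ++ C :: Δ₂) D →
      Good (Δ₁ ++ Γ ++ Fm1.ldiv A C :: Δ₂) D →
      DervTgood T Good (Δ₁ ++ Γ ++ Fm1.ldiv A C :: Δ₂) D
  | ldiv_r (Γ : List Fm1) (A C : Fm1) :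
      DervTgood T Good (A :: Γ) C → Good Γ (Fm1.ldiv A C) →
      DervTgood T Good Γ (Fm1.ldiv A C)
  | mul_l (Δ₁ Δ₂ : List Fm1) (A B D : Fm1) :
      DervTgood T Good (Δ₁ ++ A :: B :: Δ₂) D →
      Good (Δ₁ ++ Fm1.mul A B :: Δ₂) D →
      DervTgood T Good (Δ₁ ++ Fm1.mul A B :: Δ₂) D
  | mul_r (Γ₁ Γ₂ : List Fm1) (A B : Fm1) :
      DervTgood T Good Γ₁ A → DervTgood T Good Γ₂ B →
      Good (Γ₁ ++ Γ₂) (Fm1.mul A B) →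
      DervTgood T Good (Γ₁ ++ Γ₂) (Fm1.mul A B)
  | one_l (Δ₁ Δ₂ : List Fm1) (A : Fm1) :
      DervTgood T Good (Δ₁ ++ Δ₂) A → Good (Δ₁ ++ Fm1.one :: Δ₂) A →
      DervTgood T Good (Δ₁ ++ Fm1.one :: Δ₂) A
  | cut (Θ Δ₁ Δ₂ : List Fm1) (A C : Fm1) :
      DervTgood T Good Θ A → DervTgood T Good (Δ₁ ++ A :: Δ₂) C →
      Good (Δ₁ ++ Θ ++ Δ₂) C →
      DervTgood T Good (Δ₁ ++ Θ ++ Δ₂) C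

/-- The formula is built from primitive types using only the product `·`. -/
def ProdOnly : Fm1 → Prop
  | Fm1.var _ => True
  | Fm1.mul A B => ProdOnly A ∧ ProdOnly B
  | _ => False

/-- A sequent contains no occurrences of `\`, `/`, `1`. -/
def ProdOnlySeq (Γ : List Fm1) (A : Fm1) : Prop :=
  (∀ F ∈ Γ, ProdOnly F) ∧ ProdOnly A

/-! ## The bracket-forgetting projection -/

/-- BFP on formulae: delete all `⟨⟩` and `[]⁻¹`. -/
def fmBFP : Fm → Fm0
  | Fm.var n => Fm0.var n
  | Fm.one => Fm0.one
  | Fm.ldiv A B => Fm0.ldiv (fmBFP A) (fmBFP B)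
  | Fm.rdiv A B => Fm0.rdiv (fmBFP A) (fmBFP B)
  | Fm.mul A B => Fm0.mul (fmBFP A) (fmBFP B)
  | Fm.dia A => fmBFP A
  | Fm.binv A => fmBFP A
  | Fm.bang A => Fm0.bang (fmBFP A)

mutual
  /-- BFP on items. -/
  def itemBFP : Item → List Fm0
    | Item.fm A => [fmBFP A]
    | Item.br Γ => metaBFP Γ
  /-- BFP on meta-formulae: delete all brackets. -/
  def metaBFP : List Item → List Fm0
    | [] => []
    | i :: Γ => itemBFP i ++ metaBFP Γ
end

/-! ## Generative grammars (semi-Thue systems) -/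

/-- A generative grammar (semi-Thue system) over symbols coded by `ℕ`. -/
structure Grammar where
  nonterminals : Finset ℕ
  terminals : Finset ℕ
  disj : Disjoint nonterminals terminals
  start : ℕ
  start_mem : start ∈ nonterminals
  prods : Finset (List ℕ × List ℕ)
  prods_wf : ∀ p ∈ prods,
    (∀ c ∈ p.1, c ∈ nonterminals ∪ terminals) ∧
    (∀ c ∈ p.2, c ∈ nonterminals ∪ terminals)

/-- One rewriting step `η α θ ⇒_G η β θ`. -/
def Grammar.Step (G : Grammar) (x y : List ℕ) : Prop :=
  ∃ p ∈ G.prods, ∃ η θ : List ℕ, x = η ++ p.1 ++ θ ∧ y = η ++ p.2 ++ θ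

/-- `⇒*_G`: reflexive-transitive closure of `⇒_G`. -/
def Grammar.Derives (G : Grammar) : List ℕ → List ℕ → Prop :=
  Relation.ReflTransGen G.Step

/-- All productions of `G` have nonempty left- and right-hand sides. -/
def Grammar.NonemptySides (G : Grammar) : Prop :=
  ∀ p ∈ G.prods, p.1 ≠ [] ∧ p.2 ≠ []

/-! ### Encoding grammars into formulae -/

/-- `u₁ · … · u_k` as an `Fm`-formula (`1` for the empty word). -/
def wordFm : List ℕ → Fm
  | [] => Fm.one
  | [a] => Fm.var a
  | a :: b :: rest => Fm.mul (Fm.var a) (wordFm (b :: rest))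

/-- `u₁ · … · u_k` as an `Fm0`-formula. -/
def wordFm0 : List ℕ → Fm0
  | [] => Fm0.one
  | [a] => Fm0.var a
  | a :: b :: rest => Fm0.mul (Fm0.var a) (wordFm0 (b :: rest))

/-- `u₁ · … · u_k` as an `Fm1`-formula. -/
def wordFm1 : List ℕ → Fm1
  | [] => Fm1.one
  | [a] => Fm1.var a
  | a :: b :: rest => Fm1.mul (Fm1.var a) (wordFm1 (b :: rest))

/-- The formula `(u₁·…·u_k) / (v₁·…·v_m)` for a production `u ⇒ v`, in `Fm`. -/
def prodFm (p : List ℕ × List ℕ) : Fm := Fm.rdiv (wordFm p.1) (wordFm p.2)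

/-- The formula `(u₁·…·u_k) / (v₁·…·v_m)` for a production `u ⇒ v`, in `Fm0`. -/
def prodFm0 (p : List ℕ × List ℕ) : Fm0 := Fm0.rdiv (wordFm0 p.1) (wordFm0 p.2)

/-- `Γ_G = !B₁, …, !Bₙ` (bracket-free). -/
noncomputable def GammaG (G : Grammar) : List Fm0 :=
  G.prods.toList.map (fun p => Fm0.bang (prodFm0 p))

/-- `Φ_G = !(1 / !B₁), …, !(1 / !Bₙ)` (bracket-free). -/
noncomputable def PhiG (G : Grammar) : List Fm0 :=
  G.prods.toList.map (fun p => Fm0.bang (Fm0.rdiv Fm0.one (Fm0.bang (prodFm0 p))))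

/-- `Γ̃_G = ![]⁻¹B₁, …, ![]⁻¹Bₙ`. -/
noncomputable def GammaTG (G : Grammar) : Meta :=
  G.prods.toList.map (fun p => Item.fm (Fm.bang (Fm.binv (prodFm p))))

/-- `Φ̃_G = !(1 / ![]⁻¹B₁), …, !(1 / ![]⁻¹Bₙ)`. -/
noncomputable def PhiTG (G : Grammar) : Meta :=
  G.prods.toList.map
    (fun p => Item.fm (Fm.bang (Fm.rdiv Fm.one (Fm.bang (Fm.binv (prodFm p))))))

/-- The theory `T_G = { v₁, …, v_m → u₁·…·u_k : (u ⇒ v) ∈ P }`. -/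
def TG (G : Grammar) : Set Seq1 :=
  { q | ∃ p ∈ G.prods, q = (p.2.map Fm1.var, wordFm1 p.1) }

/-! ## Effective encodings of sequents into `ℕ` -/

/-- An effective injective code of `!bL1`-formulae. -/
def encFm : Fm → ℕ
  | Fm.var n => Nat.pair 0 n
  | Fm.one => Nat.pair 1 0
  | Fm.ldiv A B => Nat.pair 2 (Nat.pair (encFm A) (encFm B))
  | Fm.rdiv A B => Nat.pair 3 (Nat.pair (encFm A) (encFm B))
  | Fm.mul A B => Nat.pair 4 (Nat.pair (encFm A) (encFm B))
  | Fm.dia A => Nat.pair 5 (encFm A)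
  | Fm.binv A => Nat.pair 6 (encFm A)
  | Fm.bang A => Nat.pair 7 (encFm A)

mutual
  /-- An effective injective code of items. -/
  def encItem : Item → ℕ
    | Item.fm A => Nat.pair 0 (encFm A)
    | Item.br Γ => Nat.pair 1 (encMeta Γ)
  /-- An effective injective code of meta-formulae. -/
  def encMeta : List Item → ℕ
    | [] => 0
    | i :: Γ => Nat.pair (encItem i) (encMeta Γ) + 1
end

/-- An effective injective code of `!bL1`-sequents. -/
def encSeqB (Γ : Meta) (A : Fm) : ℕ := Nat.pair (encMeta Γ) (encFm A)

/-- An effective injective code of bracket-free formulae. -/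
def encFm0 : Fm0 → ℕ
  | Fm0.var n => Nat.pair 0 n
  | Fm0.one => Nat.pair 1 0
  | Fm0.ldiv A B => Nat.pair 2 (Nat.pair (encFm0 A) (encFm0 B))
  | Fm0.rdiv A B => Nat.pair 3 (Nat.pair (encFm0 A) (encFm0 B))
  | Fm0.mul A B => Nat.pair 4 (Nat.pair (encFm0 A) (encFm0 B))
  | Fm0.bang A => Nat.pair 5 (encFm0 A)

/-- An effective injective code of `!L1`/`!wL1`-sequents. -/
def encSeq0 (Γ : List Fm0) (A : Fm0) : ℕ :=
  Nat.pair ((Γ.map encFm0).foldr (fun a r => Nat.pair a r + 1) 0) (encFm0 A)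

/-! ## Sizes -/

/-- Size (number of symbols) of a formula. -/
def fmSize : Fm → ℕ
  | Fm.var _ => 1
  | Fm.one => 1
  | Fm.ldiv A B => fmSize A + fmSize B + 1
  | Fm.rdiv A B => fmSize A + fmSize B + 1
  | Fm.mul A B => fmSize A + fmSize B + 1
  | Fm.dia A => fmSize A + 1
  | Fm.binv A => fmSize A + 1
  | Fm.bang A => fmSize A + 1

mutual
  /-- Size of an item. -/
  def itemSize : Item → ℕ
    | Item.fm A => fmSize A
    | Item.br Γ => metaSize Γ + 1
  /-- Size of a meta-formula. -/
  def metaSize : List Item → ℕ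
    | [] => 0
    | i :: Γ => itemSize i + metaSize Γ
end

/-! ## Polarity and the bracket non-negative condition -/

/-- `cleanFm pol A`: the formula `A`, all of whose subformula occurrences have
their polarity in the sequent tracked starting from `pol` (`true` = positive),
contains no `[]⁻¹`-subformula at positive polarity and no `⟨⟩`-subformula at
negative polarity. -/
def cleanFm : Bool → Fm → Prop
  | _, Fm.var _ => True
  | _, Fm.one => True
  | pol, Fm.ldiv A B => cleanFm (!pol) A ∧ cleanFm pol B
  | pol, Fm.rdiv B A => cleanFm pol B ∧ cleanFm (!pol) A
  | pol, Fm.mul A B => cleanFm pol A ∧ cleanFm pol B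
  | pol, Fm.dia A => pol = true ∧ cleanFm pol A
  | pol, Fm.binv A => pol = false ∧ cleanFm pol A
  | pol, Fm.bang A => cleanFm pol A

/-- `bnnFm pol A`: every negative occurrence of a `!`-subformula of `A`
(where `A` itself occurs at polarity `pol` in the sequent) includes no
positive occurrence of `[]⁻¹C` and no negative occurrence of `⟨⟩C`. -/
def bnnFm : Bool → Fm → Prop
  | _, Fm.var _ => True
  | _, Fm.one => True
  | pol, Fm.ldiv A B => bnnFm (!pol) A ∧ bnnFm pol B
  | pol, Fm.rdiv B A => bnnFm pol B ∧ bnnFm (!pol) A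
  | pol, Fm.mul A B => bnnFm pol A ∧ bnnFm pol B
  | pol, Fm.dia A => bnnFm pol A
  | pol, Fm.binv A => bnnFm pol A
  | pol, Fm.bang A => (pol = false → cleanFm false A) ∧ bnnFm pol A

mutual
  /-- The bracket non-negative condition for an item of an antecedent. -/
  def bnnItem : Item → Prop
    | Item.fm A => bnnFm false A
    | Item.br Γ => bnnMeta Γ
  /-- The bracket non-negative condition for an antecedent. -/
  def bnnMeta : List Item → Prop
    | [] => True
    | i :: Γ => bnnItem i ∧ bnnMeta Γ
end

/-- The sequent `Γ → C` obeys the bracket non-negative condition. -/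
def bnnSeq (Γ : Meta) (C : Fm) : Prop := bnnMeta Γ ∧ bnnFm true C

/-! ## The formulation of `!bL1` with the generalized permutation rule -/

/-- `interleave Δ₀ [(A₁,Δ₁), …, (A_k,Δ_k)] = Δ₀, !A₁, Δ₁, …, !A_k, Δ_k`. -/
def interleave : Meta → List (Fm × Meta) → Meta
  | Δ₀, [] => Δ₀
  | Δ₀, (A, Δ) :: rest => Δ₀ ++ Item.fm (Fm.bang A) :: interleave Δ rest

/-- Derivations in the formulation of `!bL1` in which `(perm₁)`, `(perm₂)` are
replaced by the generalized permutation rule `(perm)*`.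
`NDervP cf b n Γ C` means: there is a derivation of `Γ → C` in which
(cut) is allowed only if `cf = true`, no two applications of `(perm)*` are
consecutive, `b` records whether the last rule applied is `(perm)*`, and the
derivation has exactly `n` rule applications (axiom instances included). -/
inductive NDervP : Bool → Bool → ℕ → Meta → Fm → Prop
  | id (cf : Bool) (A : Fm) : NDervP cf false 1 [Item.fm A] A
  | one_r (cf : Bool) : NDervP cf false 1 [] Fm.one
  | rdiv_l (cf b₁ b₂ : Bool) (n₁ n₂ : ℕ) (Δ : Ctx) (Γ : Meta) (B C D : Fm) :
      NDervP cf b₁ n₁ Γ B → NDervP cf b₂ n₂ (Δ.fill [Item.fm C]) D →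
      NDervP cf false (n₁ + n₂ + 1) (Δ.fill (Item.fm (Fm.rdiv C B) :: Γ)) D
  | rdiv_r (cf b : Bool) (n : ℕ) (Γ : Meta) (B C : Fm) :
      NDervP cf b n (Γ ++ [Item.fm B]) C → NDervP cf false (n + 1) Γ (Fm.rdiv C B)
  | ldiv_l (cf b₁ b₂ : Bool) (n₁ n₂ : ℕ) (Δ : Ctx) (Γ : Meta) (A C D : Fm) :
      NDervP cf b₁ n₁ Γ A → NDervP cf b₂ n₂ (Δ.fill [Item.fm C]) D →
      NDervP cf false (n₁ + n₂ + 1) (Δ.fill (Γ ++ [Item.fm (Fm.ldiv A C)])) D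
  | ldiv_r (cf b : Bool) (n : ℕ) (Γ : Meta) (A C : Fm) :
      NDervP cf b n (Item.fm A :: Γ) C → NDervP cf false (n + 1) Γ (Fm.ldiv A C)
  | mul_l (cf b : Bool) (n : ℕ) (Δ : Ctx) (A B D : Fm) :
      NDervP cf b n (Δ.fill [Item.fm A, Item.fm B]) D →
      NDervP cf false (n + 1) (Δ.fill [Item.fm (Fm.mul A B)]) D
  | mul_r (cf b₁ b₂ : Bool) (n₁ n₂ : ℕ) (Γ₁ Γ₂ : Meta) (A B : Fm) :
      NDervP cf b₁ n₁ Γ₁ A → NDervP cf b₂ n₂ Γ₂ B →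
      NDervP cf false (n₁ + n₂ + 1) (Γ₁ ++ Γ₂) (Fm.mul A B)
  | one_l (cf b : Bool) (n : ℕ) (Δ : Ctx) (A : Fm) :
      NDervP cf b n (Δ.fill []) A → NDervP cf false (n + 1) (Δ.fill [Item.fm Fm.one]) A
  | dia_l (cf b : Bool) (n : ℕ) (Δ : Ctx) (A C : Fm) :
      NDervP cf b n (Δ.fill [Item.br [Item.fm A]]) C →
      NDervP cf false (n + 1) (Δ.fill [Item.fm (Fm.dia A)]) C
  | dia_r (cf b : Bool) (n : ℕ) (Θ : Meta) (A : Fm) :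
      NDervP cf b n Θ A → NDervP cf false (n + 1) [Item.br Θ] (Fm.dia A)
  | binv_l (cf b : Bool) (n : ℕ) (Δ : Ctx) (A C : Fm) :
      NDervP cf b n (Δ.fill [Item.fm A]) C →
      NDervP cf false (n + 1) (Δ.fill [Item.br [Item.fm (Fm.binv A)]]) C
  | binv_r (cf b : Bool) (n : ℕ) (Θ : Meta) (A : Fm) :
      NDervP cf b n [Item.br Θ] A → NDervP cf false (n + 1) Θ (Fm.binv A)
  | bang_l (cf b : Bool) (n : ℕ) (Δ : Ctx) (A B : Fm) :
      NDervP cf b n (Δ.fill [Item.fm A]) B →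
      NDervP cf false (n + 1) (Δ.fill [Item.fm (Fm.bang A)]) B
  | bang_r (cf b : Bool) (n : ℕ) (Φ : List Fm) (A : Fm) :
      NDervP cf b n (bangs Φ) A → NDervP cf false (n + 1) (bangs Φ) (Fm.bang A)
  | contr (cf b : Bool) (n : ℕ) (Δ : Ctx) (Φ : List Fm) (Γ : Meta) (B : Fm) :
      Φ ≠ [] →
      NDervP cf b n (Δ.fill (bangs Φ ++ [Item.br (bangs Φ ++ Γ)])) B →
      NDervP cf false (n + 1) (Δ.fill (bangs Φ ++ Γ)) B
  | permStar (cf : Bool) (n : ℕ) (Δ : Ctx) (Δ₀ : Meta) (L L' : List (Fm × Meta)) (C : Fm) :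
      L.map Prod.snd = L'.map Prod.snd →
      (L.map Prod.fst).Perm (L'.map Prod.fst) →
      NDervP cf false n (Δ.fill (interleave Δ₀ L)) C →
      NDervP cf true (n + 1) (Δ.fill (interleave Δ₀ L')) C
  | cut (b₁ b₂ : Bool) (n₁ n₂ : ℕ) (Δ : Ctx) (Θ : Meta) (A C : Fm) :
      NDervP true b₁ n₁ Θ A → NDervP true b₂ n₂ (Δ.fill [Item.fm A]) C →
      NDervP true false (n₁ + n₂ + 1) (Δ.fill Θ) C

/-! ## Cut elimination through a phase model of cut-free derivability -/

namespace DervL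

/-- A block of `!`-formulae may be weakened in. -/
theorem weak_list {cf : Bool} (Φ Δ₁ Δ₂ : List Fm0) (C : Fm0)
    (h : DervL true cf (Δ₁ ++ Δ₂) C) :
    DervL true cf (Δ₁ ++ Φ.map Fm0.bang ++ Δ₂) C := by
  induction Φ with
  | nil => simpa using h
  | cons A Φ ih =>
    have := weak cf Δ₁ (Φ.map Fm0.bang ++ Δ₂) A C (by simpa using ih)
    simpa using this

/-- A block of `!`-formulae may be moved to the right. -/
theorem perm_list_right {w cf : Bool} (Φ Δ₁ Γ Δ₂ : List Fm0) (C : Fm0)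
    (h : DervL w cf (Δ₁ ++ Φ.map Fm0.bang ++ Γ ++ Δ₂) C) :
    DervL w cf (Δ₁ ++ Γ ++ Φ.map Fm0.bang ++ Δ₂) C := by
  induction Φ generalizing Δ₁ Γ with
  | nil => simpa using h
  | cons A Φ ih =>
    have h₁ := ih (Δ₁ ++ [Fm0.bang A]) Γ (by simpa using h)
    have h₂ := perm1 w cf Δ₁ Γ (Φ.map Fm0.bang ++ Δ₂) A C (by simpa using h₁)
    simpa using h₂

/-- A block of `!`-formulae may be moved to the left. -/
theorem perm_list_left {w cf : Bool} (Φ Δ₁ Γ Δ₂ : List Fm0) (C : Fm0)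
    (h : DervL w cf (Δ₁ ++ Γ ++ Φ.map Fm0.bang ++ Δ₂) C) :
    DervL w cf (Δ₁ ++ Φ.map Fm0.bang ++ Γ ++ Δ₂) C := by
  induction Φ generalizing Δ₁ Γ with
  | nil => simpa using h
  | cons A Φ ih =>
    have h₁ := perm2 w cf Δ₁ Γ (Φ.map Fm0.bang ++ Δ₂) A C (by simpa using h)
    have h₂ := ih (Δ₁ ++ [Fm0.bang A]) Γ (by simpa using h₁)
    simpa using h₂

/-- Two adjacent copies of a block of `!`-formulae may be contracted. -/
theorem contr_list {w cf : Bool} (Φ Δ₁ Δ₂ : List Fm0) (C : Fm0)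
    (h : DervL w cf (Δ₁ ++ Φ.map Fm0.bang ++ Φ.map Fm0.bang ++ Δ₂) C) :
    DervL w cf (Δ₁ ++ Φ.map Fm0.bang ++ Δ₂) C := by
  induction Φ generalizing Δ₁ with
  | nil => simpa using h
  | cons A Φ ih =>
    have h₁ := perm2 w cf (Δ₁ ++ [Fm0.bang A]) (Φ.map Fm0.bang)
      (Φ.map Fm0.bang ++ Δ₂) A C (by simpa using h)
    have h₂ := contr w cf Δ₁ (Φ.map Fm0.bang ++ (Φ.map Fm0.bang ++ Δ₂)) A C
      (by simpa using h₁)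
    have h₃ := ih (Δ₁ ++ [Fm0.bang A]) (by simpa using h₂)
    simpa using h₃

end DervL

/-- The closure of a set of antecedents: `Γ` belongs to it when `Γ` may replace the
members of `X` in every context in which all of them are cut-free derivable. -/
def phaseClosure (w : Bool) (X : Set (List Fm0)) : Set (List Fm0) :=
  {Γ | ∀ Δ₁ Δ₂ C, (∀ Γ' ∈ X, DervL w false (Δ₁ ++ Γ' ++ Δ₂) C) →
    DervL w false (Δ₁ ++ Γ ++ Δ₂) C}

/-- A fact of the phase model: a set of antecedents equal to its closure. -/
def IsFact (w : Bool) (X : Set (List Fm0)) : Prop := phaseClosure w X ⊆ X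

/-- The antecedents consisting of `!`-formulae. -/
def bangLists : Set (List Fm0) := Set.range (List.map Fm0.bang)

theorem append_mem_bangLists {x y : List Fm0} (hx : x ∈ bangLists) (hy : y ∈ bangLists) :
    x ++ y ∈ bangLists := by
  obtain ⟨Φ, rfl⟩ := hx
  obtain ⟨Ψ, rfl⟩ := hy
  exact ⟨Φ ++ Ψ, by simp⟩

theorem subset_phaseClosure (w : Bool) (X : Set (List Fm0)) : X ⊆ phaseClosure w X :=
  fun Γ hΓ _ _ _ h => h Γ hΓ

theorem isFact_phaseClosure (w : Bool) (X : Set (List Fm0)) : IsFact w (phaseClosure w X) :=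
  fun _ hΓ Δ₁ Δ₂ C h => hΓ Δ₁ Δ₂ C fun _ hΓ' => hΓ' Δ₁ Δ₂ C h

theorem isFact_derivable (w : Bool) (A : Fm0) : IsFact w {Γ | DervL w false Γ A} :=
  fun Γ hΓ => by simpa using hΓ [] [] A (by simp)

/-- A fact containing `X` in a given context contains the closure of `X` in that context. -/
theorem IsFact.mem_of_mem_phaseClosure {w : Bool} {X Y : Set (List Fm0)} (hY : IsFact w Y)
    {x u v : List Fm0} (hx : x ∈ phaseClosure w X) (h : ∀ x' ∈ X, u ++ x' ++ v ∈ Y) :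
    u ++ x ++ v ∈ Y := by
  refine hY fun Δ₁ Δ₂ C hC => ?_
  have := hx (Δ₁ ++ u) (v ++ Δ₂) C fun x' hx' => by simpa using hC _ (h x' hx')
  simpa using this

/-- The value of a formula in the phase model of cut-free derivability. -/
def interp (w : Bool) : Fm0 → Set (List Fm0)
  | Fm0.var n => {Γ | DervL w false Γ (Fm0.var n)}
  | Fm0.one => phaseClosure w {[]}
  | Fm0.ldiv A C => {z | ∀ x ∈ interp w A, x ++ z ∈ interp w C}
  | Fm0.rdiv C B => {z | ∀ x ∈ interp w B, z ++ x ∈ interp w C}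
  | Fm0.mul A B => phaseClosure w (Set.image2 (· ++ ·) (interp w A) (interp w B))
  | Fm0.bang A => phaseClosure w (bangLists ∩ interp w A)

theorem isFact_interp (w : Bool) (A : Fm0) : IsFact w (interp w A) := by
  induction A with
  | var n => exact isFact_derivable w _
  | one => exact isFact_phaseClosure w _
  | ldiv A C _ ihC =>
    intro z hz x hx
    simpa using ihC.mem_of_mem_phaseClosure (u := x) (v := []) hz
      fun z' hz' => by simpa using hz' x hx
  | rdiv C B ihC _ =>
    intro z hz x hx
    simpa using ihC.mem_of_mem_phaseClosure (u := []) (v := x) hz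
      fun z' hz' => by simpa using hz' x hx
  | mul A B => exact isFact_phaseClosure w _
  | bang A => exact isFact_phaseClosure w _

/-- Every formula, as an antecedent, belongs to its value, and all antecedents in its value
cut-free derive it. -/
theorem singleton_mem_interp_and_interp_subset (w : Bool) (A : Fm0) :
    [A] ∈ interp w A ∧ interp w A ⊆ {Γ | DervL w false Γ A} := by
  induction A with
  | var n => exact ⟨DervL.id w false _, subset_rfl⟩
  | one =>
    refine ⟨fun Δ₁ Δ₂ C h => ?_, fun Γ hΓ => ?_⟩
    · simpa using DervL.one_l w false Δ₁ Δ₂ C (by simpa using h [] rfl)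
    · simpa using hΓ [] [] Fm0.one (by simpa using DervL.one_r w false)
  | ldiv A C ihA ihC =>
    refine ⟨fun x hx => isFact_interp w C fun Δ₁ Δ₂ D h => ?_, fun Γ hΓ => ?_⟩
    · simpa using DervL.ldiv_l w false x Δ₁ Δ₂ A C D (ihA.2 hx) (by simpa using h _ ihC.1)
    · exact DervL.ldiv_r w false Γ A C (ihC.2 (hΓ _ ihA.1))
  | rdiv C B ihC ihB =>
    refine ⟨fun x hx => isFact_interp w C fun Δ₁ Δ₂ D h => ?_, fun Γ hΓ => ?_⟩
    · simpa using DervL.rdiv_l w false x Δ₁ Δ₂ B C D (ihB.2 hx) (by simpa using h _ ihC.1)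
    · exact DervL.rdiv_r w false Γ B C (ihC.2 (hΓ _ ihB.1))
  | mul A B ihA ihB =>
    refine ⟨fun Δ₁ Δ₂ D h => ?_, fun Γ hΓ => ?_⟩
    · have := h ([A] ++ [B]) ⟨_, ihA.1, _, ihB.1, rfl⟩
      simpa using DervL.mul_l w false Δ₁ Δ₂ A B D (by simpa using this)
    · have := hΓ [] [] (Fm0.mul A B) <| by
        rintro _ ⟨x, hx, y, hy, rfl⟩
        simpa using DervL.mul_r w false x y A B (ihA.2 hx) (ihB.2 hy)
      simpa using this
  | bang A ih =>
    refine ⟨subset_phaseClosure w _ ⟨⟨[A], rfl⟩, isFact_interp w A fun Δ₁ Δ₂ D h => ?_⟩,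
      fun Γ hΓ => ?_⟩
    · simpa using DervL.bang_l w false Δ₁ Δ₂ A D (by simpa using h _ ih.1)
    · have := hΓ [] [] (Fm0.bang A) <| by
        rintro _ ⟨⟨Φ, rfl⟩, hx⟩
        simpa using DervL.bang_r w false Φ A (ih.2 hx)
      simpa using this

/-- The value of an antecedent: the elementwise concatenations of the values of its formulae. -/
def interpList (w : Bool) : List Fm0 → Set (List Fm0)
  | [] => {[]}
  | A :: Γ => Set.image2 (· ++ ·) (interp w A) (interpList w Γ)

theorem mem_interpList_nil {w : Bool} {z : List Fm0} : z ∈ interpList w [] ↔ z = [] :=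
  Iff.rfl

theorem mem_interpList_cons {w : Bool} {A : Fm0} {Γ z : List Fm0} :
    z ∈ interpList w (A :: Γ) ↔ ∃ x ∈ interp w A, ∃ y ∈ interpList w Γ, x ++ y = z :=
  Iff.rfl

theorem mem_interpList_append {w : Bool} {Γ Δ z : List Fm0} :
    z ∈ interpList w (Γ ++ Δ) ↔
      ∃ x ∈ interpList w Γ, ∃ y ∈ interpList w Δ, x ++ y = z := by
  induction Γ generalizing z with
  | nil => simp [mem_interpList_nil]
  | cons A Γ ih =>
    simp only [List.cons_append, mem_interpList_cons, ih]
    constructor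
    · rintro ⟨x, hx, _, ⟨y, hy, v, hv, rfl⟩, rfl⟩
      exact ⟨_, ⟨x, hx, y, hy, rfl⟩, v, hv, by simp⟩
    · rintro ⟨_, ⟨x, hx, y, hy, rfl⟩, v, hv, rfl⟩
      exact ⟨x, hx, _, ⟨y, hy, v, hv, rfl⟩, by simp⟩

/-- In the value of an antecedent of `!`-formulae, only the members that are themselves
sequences of `!`-formulae matter for membership in a fact. -/
theorem IsFact.mem_of_mem_interpList_bang {w : Bool} {Y : Set (List Fm0)} (hY : IsFact w Y)
    (Φ : List Fm0) (u : List Fm0)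
    (h : ∀ z ∈ bangLists ∩ interpList w (Φ.map Fm0.bang), u ++ z ∈ Y)
    {z : List Fm0} (hz : z ∈ interpList w (Φ.map Fm0.bang)) : u ++ z ∈ Y := by
  induction Φ generalizing u z with
  | nil => exact h z ⟨⟨[], (mem_interpList_nil.1 hz).symm⟩, hz⟩
  | cons A Φ ih =>
    obtain ⟨x, hx, y, hy, rfl⟩ := hz
    have := hY.mem_of_mem_phaseClosure (u := u) (v := y) hx fun x' hx' =>
      ih (u ++ x') (fun y' hy' => by
        simpa using h (x' ++ y') ⟨append_mem_bangLists hx'.1 hy'.1,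
          x', subset_phaseClosure w _ hx', y', hy'.2, rfl⟩) hy
    simpa using this

/-- The phase model of cut-free derivability is sound for derivations with cut. -/
theorem interpList_subset_interp {w cf : Bool} {Γ : List Fm0} {C : Fm0}
    (h : DervL w cf Γ C) : interpList w Γ ⊆ interp w C := by
  induction h with
  | id w cf A =>
    rintro _ ⟨x, hx, _, rfl, rfl⟩
    simpa using hx
  | one_r w cf => exact subset_phaseClosure w _
  | rdiv_l w cf Γ Δ₁ Δ₂ B C D _ _ ih₁ ih₂ =>
    intro z hz
    simp only [mem_interpList_append, mem_interpList_cons] at hz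
    obtain ⟨d₁, hd₁, _, ⟨f, hf, _, ⟨g, hg, d₂, hd₂, rfl⟩, rfl⟩, rfl⟩ := hz
    simpa using ih₂ (mem_interpList_append.2 ⟨d₁, hd₁, _, ⟨_, hf g (ih₁ hg), d₂, hd₂, rfl⟩, rfl⟩)
  | rdiv_r w cf Γ B C _ ih =>
    intro z hz x hx
    exact ih (mem_interpList_append.2 ⟨z, hz, x, ⟨x, hx, [], rfl, by simp⟩, rfl⟩)
  | ldiv_l w cf Γ Δ₁ Δ₂ A C D _ _ ih₁ ih₂ =>
    intro z hz
    simp only [mem_interpList_append, mem_interpList_cons] at hz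
    obtain ⟨_, ⟨d₁, hd₁, g, hg, rfl⟩, _, ⟨f, hf, d₂, hd₂, rfl⟩, rfl⟩ := hz
    simpa using ih₂ (mem_interpList_append.2 ⟨d₁, hd₁, _, ⟨_, hf g (ih₁ hg), d₂, hd₂, rfl⟩, rfl⟩)
  | ldiv_r w cf Γ A C _ ih => exact fun z hz x hx => ih ⟨x, hx, z, hz, rfl⟩
  | mul_l w cf Δ₁ Δ₂ A B D _ ih =>
    intro z hz
    simp only [mem_interpList_append, mem_interpList_cons] at hz
    obtain ⟨d₁, hd₁, _, ⟨f, hf, d₂, hd₂, rfl⟩, rfl⟩ := hz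
    rw [← List.append_assoc]
    refine (isFact_interp w D).mem_of_mem_phaseClosure hf ?_
    rintro _ ⟨x, hx, y, hy, rfl⟩
    simpa using ih (mem_interpList_append.2
      ⟨d₁, hd₁, _, ⟨x, hx, _, ⟨y, hy, d₂, hd₂, rfl⟩, rfl⟩, rfl⟩)
  | mul_r w cf Γ₁ Γ₂ A B _ _ ih₁ ih₂ =>
    intro z hz
    obtain ⟨x, hx, y, hy, rfl⟩ := mem_interpList_append.1 hz
    exact subset_phaseClosure w _ ⟨x, ih₁ hx, y, ih₂ hy, rfl⟩
  | one_l w cf Δ₁ Δ₂ A _ ih =>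
    intro z hz
    simp only [mem_interpList_append, mem_interpList_cons] at hz
    obtain ⟨d₁, hd₁, _, ⟨f, hf, d₂, hd₂, rfl⟩, rfl⟩ := hz
    rw [← List.append_assoc]
    refine (isFact_interp w A).mem_of_mem_phaseClosure hf ?_
    rintro _ rfl
    simpa using ih (mem_interpList_append.2 ⟨d₁, hd₁, d₂, hd₂, rfl⟩)
  | bang_l w cf Δ₁ Δ₂ A B _ ih =>
    intro z hz
    simp only [mem_interpList_append, mem_interpList_cons] at hz
    obtain ⟨d₁, hd₁, _, ⟨f, hf, d₂, hd₂, rfl⟩, rfl⟩ := hz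
    rw [← List.append_assoc]
    refine (isFact_interp w B).mem_of_mem_phaseClosure hf fun x hx => ?_
    simpa using ih (mem_interpList_append.2 ⟨d₁, hd₁, _, ⟨x, hx.2, d₂, hd₂, rfl⟩, rfl⟩)
  | bang_r w cf Φ A _ ih =>
    intro z hz
    exact (isFact_interp w (Fm0.bang A)).mem_of_mem_interpList_bang Φ []
      (fun z' hz' => subset_phaseClosure w _ ⟨hz'.1, ih hz'.2⟩) hz
  | perm1 w cf Δ₁ Γ Δ₂ A B _ ih =>
    intro z hz
    simp only [mem_interpList_append, mem_interpList_cons] at hz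
    obtain ⟨_, ⟨d₁, hd₁, g, hg, rfl⟩, _, ⟨f, hf, d₂, hd₂, rfl⟩, rfl⟩ := hz
    rw [← List.append_assoc]
    refine (isFact_interp w B).mem_of_mem_phaseClosure hf ?_
    rintro _ ⟨⟨Φ, rfl⟩, hx⟩
    have := ih (mem_interpList_append.2 ⟨d₁, hd₁, _,
      ⟨_, subset_phaseClosure w _ ⟨⟨Φ, rfl⟩, hx⟩, _,
        mem_interpList_append.2 ⟨g, hg, d₂, hd₂, rfl⟩, rfl⟩, rfl⟩)
    refine isFact_interp w B fun E₁ E₂ D h => ?_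
    simpa using DervL.perm_list_right Φ (E₁ ++ d₁) g (d₂ ++ E₂) D (by simpa using h _ this)
  | perm2 w cf Δ₁ Γ Δ₂ A B _ ih =>
    intro z hz
    simp only [mem_interpList_append, mem_interpList_cons] at hz
    obtain ⟨d₁, hd₁, _, ⟨f, hf, _, ⟨g, hg, d₂, hd₂, rfl⟩, rfl⟩, rfl⟩ := hz
    rw [← List.append_assoc]
    refine (isFact_interp w B).mem_of_mem_phaseClosure hf ?_
    rintro _ ⟨⟨Φ, rfl⟩, hx⟩
    have := ih (mem_interpList_append.2 ⟨_, mem_interpList_append.2 ⟨d₁, hd₁, g, hg, rfl⟩, _,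
      ⟨_, subset_phaseClosure w _ ⟨⟨Φ, rfl⟩, hx⟩, d₂, hd₂, rfl⟩, rfl⟩)
    refine isFact_interp w B fun E₁ E₂ D h => ?_
    simpa using DervL.perm_list_left Φ (E₁ ++ d₁) g (d₂ ++ E₂) D (by simpa using h _ this)
  | contr w cf Δ₁ Δ₂ A B _ ih =>
    intro z hz
    simp only [mem_interpList_append, mem_interpList_cons] at hz
    obtain ⟨d₁, hd₁, _, ⟨f, hf, d₂, hd₂, rfl⟩, rfl⟩ := hz
    rw [← List.append_assoc]
    refine (isFact_interp w B).mem_of_mem_phaseClosure hf ?_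
    rintro _ ⟨⟨Φ, rfl⟩, hx⟩
    have hΦ : Φ.map Fm0.bang ∈ interp w (Fm0.bang A) :=
      subset_phaseClosure w _ ⟨⟨Φ, rfl⟩, hx⟩
    have := ih (mem_interpList_append.2 ⟨d₁, hd₁, _,
      ⟨_, hΦ, _, ⟨_, hΦ, d₂, hd₂, rfl⟩, rfl⟩, rfl⟩)
    refine isFact_interp w B fun E₁ E₂ D h => ?_
    simpa using DervL.contr_list Φ (E₁ ++ d₁) (d₂ ++ E₂) D (by simpa using h _ this)
  | weak cf Δ₁ Δ₂ A B _ ih =>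
    intro z hz
    simp only [mem_interpList_append, mem_interpList_cons] at hz
    obtain ⟨d₁, hd₁, _, ⟨f, hf, d₂, hd₂, rfl⟩, rfl⟩ := hz
    rw [← List.append_assoc]
    refine (isFact_interp true B).mem_of_mem_phaseClosure hf ?_
    rintro _ ⟨⟨Φ, rfl⟩, -⟩
    have := ih (mem_interpList_append.2 ⟨d₁, hd₁, d₂, hd₂, rfl⟩)
    refine isFact_interp true B fun E₁ E₂ D h => ?_
    simpa using DervL.weak_list Φ (E₁ ++ d₁) (d₂ ++ E₂) D (by simpa using h _ this)
  | cut w Θ Δ₁ Δ₂ A C _ _ ih₁ ih₂ =>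
    intro z hz
    simp only [mem_interpList_append] at hz
    obtain ⟨_, ⟨d₁, hd₁, t, ht, rfl⟩, d₂, hd₂, rfl⟩ := hz
    simpa using ih₂ (mem_interpList_append.2 ⟨d₁, hd₁, _, ⟨t, ih₁ ht, d₂, hd₂, rfl⟩, rfl⟩)

theorem self_mem_interpList (w : Bool) (Γ : List Fm0) : Γ ∈ interpList w Γ := by
  induction Γ with
  | nil => rfl
  | cons A Γ ih => exact ⟨[A], (singleton_mem_interp_and_interp_subset w A).1, Γ, ih, rfl⟩

/-- Cut elimination for `!L1` (`w = false`) and `!wL1` (`w = true`). -/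
theorem DervL.cut_free {w cf : Bool} {Γ : List Fm0} {C : Fm0} (h : DervL w cf Γ C) :
    DervL w false Γ C :=
  (singleton_mem_interp_and_interp_subset w C).2
    (interpList_subset_interp h (self_mem_interpList w Γ))

/-- Every sequent derivable in `!L1` has a cut-free
derivation in `!L1`, and every sequent derivable in `!wL1` has a cut-free
derivation in `!wL1`. -/
theorem cut_elimination_L :
    (∀ (Γ : List Fm0) (C : Fm0), DervL false true Γ C → DervL false false Γ C) ∧
    (∀ (Γ : List Fm0) (C : Fm0), DervL true true Γ C → DervL true false Γ C) :=
  ⟨fun _ _ h => h.cut_free, fun _ _ h => h.cut_free⟩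

end Lambek
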